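/- For every n ≥ 0 and every P ∈ D_n^{h,≥}, the number of occurrences of the factor UU in P (equivalently of DD) equals the number of U steps in φ(P) plus the number of occurrences of UU in φ(P) plus the number of occurrences of UF in φ(P). -/

import Mathlib

inductive Step : Type
  | U | D | F
  deriving DecidableEq, Repr

open Step

/-- Number of occurrences of `p` as a factor (consecutive steps) of `w`. -/
def countFactor (p w : List Step) : ℕ :=
  w.tails.countP fun t => p.isPrefixOf t

/-- `w` is a Dyck path (word over {U,D} with as many U's as D's,
every prefix having at least as many U's as D's). -/
def IsDyck (w : List Step) : Prop :=
  w.count F = 0 ∧ w.count U = w.count D ∧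
    ∀ p : List Step, p <+: w → p.count D ≤ p.count U

/-- `w` is a Motzkin path. -/
def IsMotzkin (w : List Step) : Prop :=
  w.count U = w.count D ∧ ∀ p : List Step, p <+: w → p.count D ≤ p.count U

/-- The (maximal) height of a path. -/
def height (w : List Step) : ℕ :=
  (w.inits.map fun p => p.count U - p.count D).foldr max 0

/-- The set `D^{h,≥}` of Dyck paths with first return decomposition
`P = U α D β` satisfying `h(UαD) ≥ h(β)`, recursively. -/
inductive DH : List Step → Prop
  | nil : DH []
  | cons (α β : List Step) : DH α → DH β →
      height (U :: (α ++ [D])) ≥ height β → DH (U :: (α ++ [D] ++ β))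

/-- The map φ from `D^{h,≥}` to Motzkin paths, as a relation:
φ(ε)=ε, φ(αUD)=φ(α)F, φ(αUUβDγD)=φ(α)φ(γ)Uφ(β)D. -/
inductive Phi : List Step → List Step → Prop
  | nil : Phi [] []
  | flat (α a : List Step) : DH α → Phi α a →
      Phi (α ++ [U, D]) (a ++ [F])
  | up (α β γ a b c : List Step) : DH α → DH β → DH γ →
      Phi α a → Phi β b → Phi γ c →
      Phi (α ++ [U, U] ++ β ++ [D] ++ γ ++ [D]) (a ++ c ++ U :: (b ++ [D]))

/-- Auxiliary: the list starts with one or more `F`'s followed by a `D`. -/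
def fThenD : List Step → Bool
  | F :: D :: _ => true
  | F :: rest => fThenD rest
  | _ => false

/-- Auxiliary: the list starts with one or more `F`'s followed by a `U`. -/
def fThenU : List Step → Bool
  | F :: U :: _ => true
  | F :: rest => fThenU rest
  | _ => false

/-- Number of occurrences of factors of the form `U F^k D` with `k ≥ 1` in `w`. -/
def countUFD (w : List Step) : ℕ :=
  w.tails.countP fun t => match t with
    | U :: rest => fThenD rest
    | _ => false

/-- Number of occurrences of factors of the form `U F^k U` with `k ≥ 1` in `w`. -/
def countUFU (w : List Step) : ℕ :=
  w.tails.countP fun t => match t with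
    | U :: rest => fThenU rest
    | _ => false

theorem countFactor_nil (p : List Step) (hp : p ≠ []) : countFactor p [] = 0 := by
  cases p <;> simp_all [countFactor]

theorem countFactor_pair_cons (x y z : Step) (l : List Step) :
    countFactor [x, y] (z :: l) =
      countFactor [x, y] l + if z = x ∧ l.head? = some y then 1 else 0 := by
  cases l with
  | nil => simp [countFactor]
  | cons w l =>
    simp [countFactor, List.countP_cons, List.isPrefixOf, @eq_comm _ x, @eq_comm _ y]

theorem countFactor_pair_append (x y : Step) (l r : List Step) :
    countFactor [x, y] (l ++ r) = countFactor [x, y] l + countFactor [x, y] r +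
      if l.getLast? = some x ∧ r.head? = some y then 1 else 0 := by
  induction l with
  | nil => simp [countFactor]
  | cons z l ih =>
    rw [List.cons_append, countFactor_pair_cons, countFactor_pair_cons, ih]
    cases l with
    | nil => simp [countFactor]
    | cons w l =>
      have hhead : (w :: l ++ r).head? = (w :: l).head? := rfl
      simp only [hhead, List.getLast?_cons_cons]
      ring

theorem countFactor_singleton (x : Step) (l : List Step) :
    countFactor [x] l = l.count x := by
  induction l with
  | nil => simp [countFactor]
  | cons z l ih =>
    rw [List.count_cons, ← ih]
    simp [countFactor, List.countP_cons, List.isPrefixOf, @eq_comm _ x]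

/-- A path and its image under `φ` are both empty, or else the path starts with `U` and ends
with `D` while its image neither starts with `D` nor ends with `U`. -/
theorem Phi.endpoints {P m : List Step} (h : Phi P m) :
    (P = [] ∧ m = []) ∨
      (P.head? = some U ∧ P.getLast? = some D ∧
        (m.head? = some U ∨ m.head? = some F) ∧
        (m.getLast? = some D ∨ m.getLast? = some F)) := by
  induction h with
  | nil => simp
  | flat α a _ _ ih =>
    rcases ih with ⟨rfl, rfl⟩ | ⟨h₁, h₂, h₃, h₄⟩
    · simp
    · rcases h₃ with h₃ | h₃ <;> simp [List.head?_append, List.getLast?_append, h₁, h₃]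
  | up α β γ a b c _ _ _ _ _ _ iha _ ihc =>
    right
    rcases iha with ⟨rfl, rfl⟩ | ⟨h₁, -, h₃ | h₃, -⟩ <;>
    rcases ihc with ⟨rfl, rfl⟩ | ⟨-, -, k₃ | k₃, -⟩ <;>
    simp [List.head?_append, List.getLast?_append, List.getLast?_cons, *]

theorem Phi.count_pairs {P m : List Step} (h : Phi P m) :
    countFactor [U, U] P =
      countFactor [U] m + countFactor [U, U] m + countFactor [U, F] m ∧
    countFactor [D, D] P =
      countFactor [U] m + countFactor [U, U] m + countFactor [U, F] m := by
  induction h with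
  | nil => simp [countFactor]
  | flat α a _ h ih =>
    simp only [countFactor_singleton] at ih ⊢
    revert ih
    rcases h.endpoints with ⟨rfl, rfl⟩ | ⟨h₁, h₂, h₃, h₄ | h₄⟩ <;>
    simp [countFactor_pair_append, countFactor_pair_cons, countFactor_nil, *]
  | up α β γ a b c _ _ _ ha hb hc iha ihb ihc =>
    simp only [countFactor_singleton] at iha ihb ihc ⊢
    revert iha ihb ihc
    rcases ha.endpoints with ⟨rfl, rfl⟩ | ⟨-, h₂, -, h₄ | h₄⟩ <;>
    rcases hb.endpoints with ⟨rfl, rfl⟩ | ⟨k₁, k₂, k₃ | k₃, k₄ | k₄⟩ <;>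
    rcases hc.endpoints with ⟨rfl, rfl⟩ | ⟨l₁, l₂, -, l₄ | l₄⟩ <;>
    simp [countFactor_pair_append, countFactor_pair_cons, countFactor_nil, List.head?_append,
      List.getLast?_append, List.getLast?_cons, -List.append_assoc, *] <;> intros <;> omega

/-- φ transports UU (equivalently DD): #UU(P) = #DD(P) = #U(φP) + #UU(φP) + #UF(φP). -/
theorem stmt11 (n : ℕ) (P m : List Step) (hP : DH P) (hlen : P.length = 2 * n)
    (hphi : Phi P m) :
    countFactor [Step.U, Step.U] P =
      countFactor [Step.U] m + countFactor [Step.U, Step.U] m +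
        countFactor [Step.U, Step.F] m ∧
    countFactor [Step.D, Step.D] P =
      countFactor [Step.U] m + countFactor [Step.U, Step.U] m +
        countFactor [Step.U, Step.F] m := by
  exact hphi.count_pairs
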